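/- Under the protocol, suppose G(t) is B-core-connected, (i,j) is a core edge, and t ≥ 2^{2/(1−α)} ⌈32B + 8B·W(0)⌉^{1/(β−α)} + (32B·‖x(0)‖_∞)^{2/(1−α)} + 1. If q_{i→j}(t) ≠ 0, then q_{i→j}(k) = 0 for every k ∈ [t+1, t+3B] at which (i,j) ∈ E(k). Here W(0) = max_k x_k(0) − min_k x_k(0) and ‖x(0)‖_∞ = max_k |x_k(0)|. -/

import Mathlib

open scoped Classical

noncomputable section

/-- The rounding function `R` sending `x` to `1`, `0`, `-1` according to `x > 1`,
`-1 ≤ x ≤ 1`, `x < -1`. -/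
def Rq (y : ℝ) : ℝ := if y > 1 then 1 else if y < -1 then -1 else 0

/-- The data and evolution equations of the ternary-message average-consensus protocol
on `n` nodes.  `E t i j` means the edge `(i,j)` is present in the graph `G(t)`
(for `t ≥ 1`); `x t i` is the value of node `i` at time `t`; `xin t i j` is
`x̂_{i,j,in}(t)`, `xout t i j` is `x̂_{i,j,out}(t)` and `q t i j` is `q_{i→j}(t)`. -/
structure Protocol (n : ℕ) where
  α : ℝ
  β : ℝ
  hα : 0 < α
  hαβ : α < β
  hβ : β < 1
  E : ℕ → Fin n → Fin n → Prop
  Esymm : ∀ t i j, E t i j → E t j i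
  Eirrefl : ∀ t i, ¬ E t i i
  D : Fin n → Fin n → ℕ → ℝ
  Dsymm : ∀ i j t, D i j t = D j i t
  Dbound : ∀ t i j, E t i j →
    ((max (Set.ncard {k | E t i k}) (Set.ncard {k | E t j k}) : ℕ) : ℝ) ≤ D i j t
  x : ℕ → Fin n → ℝ
  xin : ℕ → Fin n → Fin n → ℝ
  xout : ℕ → Fin n → Fin n → ℝ
  q : ℕ → Fin n → Fin n → ℝ
  hxin0 : ∀ i j, xin 0 i j = 0
  hxout0 : ∀ i j, xout 0 i j = 0
  hq : ∀ t, 1 ≤ t → ∀ i j, E t i j →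
    q t i j = Rq ((t : ℝ) ^ α * (x (t - 1) i - xout (t - 1) i j))
  hxoutE : ∀ t, 1 ≤ t → ∀ i j, E t i j →
    xout t i j = xout (t - 1) i j + q t i j / (t : ℝ) ^ α
  hxinE : ∀ t, 1 ≤ t → ∀ i j, E t i j →
    xin t i j = xin (t - 1) i j + q t j i / (t : ℝ) ^ α
  hxoutN : ∀ t, 1 ≤ t → ∀ i j, ¬ E t i j → xout t i j = xout (t - 1) i j
  hxinN : ∀ t, 1 ≤ t → ∀ i j, ¬ E t i j → xin t i j = xin (t - 1) i j
  hx : ∀ t, 1 ≤ t → ∀ i, x t i = x (t - 1) i + (1 / (t : ℝ) ^ β) *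
    ∑ j ∈ Finset.univ.filter (fun j => E t i j ∧
        4 / (t : ℝ) ^ α < |xin t i j - xout t i j| ∧ q t j i = 0 ∧ q t i j = 0),
      (xin t i j - xout t i j) / (4 * D i j t)

namespace Protocol

variable {n : ℕ} (P : Protocol n)

/-- The set `S(i,t)` of neighbors that node `i` includes in its update at time `t`. -/
def S (t : ℕ) (i : Fin n) : Finset (Fin n) :=
  Finset.univ.filter (fun j => P.E t i j ∧
    4 / (t : ℝ) ^ P.α < |P.xin t i j - P.xout t i j| ∧ P.q t j i = 0 ∧ P.q t i j = 0)

/-- The graph sequence of the protocol is `B`-core-connected with core edge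
relation `Einf`: every core edge appears at some time, the graph of core edges is
connected, and every core edge appears in every time window `[kB+1, (k+1)B]`. -/
def CoreConnected (B : ℕ) (Einf : Fin n → Fin n → Prop) : Prop :=
  (∀ i j, Einf i j → ∃ t, 1 ≤ t ∧ P.E t i j) ∧
  (SimpleGraph.fromRel Einf).Connected ∧
  ∀ k : ℕ, ∀ i j, Einf i j → ∃ t, k * B + 1 ≤ t ∧ t ≤ (k + 1) * B ∧ P.E t i j

end Protocol

/-- `M(x)`: the largest coordinate. -/
def maxV {n : ℕ} (y : Fin n → ℝ) : ℝ := ⨆ i, y i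

/-- `m(x)`: the smallest coordinate. -/
def minV {n : ℕ} (y : Fin n → ℝ) : ℝ := ⨅ i, y i

/-- `W(x) = M(x) - m(x)`. -/
def Wsp {n : ℕ} (y : Fin n → ℝ) : ℝ := maxV y - minV y

/-- The sup norm `‖x‖_∞ = max_i |x_i|`. -/
def normInf {n : ℕ} (y : Fin n → ℝ) : ℝ := ⨆ i, |y i|

/-- `V2(x) = sqrt(Σ_i (x_i - (1/n) Σ_j x_j)²)`. -/
def V2 {n : ℕ} (y : Fin n → ℝ) : ℝ :=
  Real.sqrt (∑ i, (y i - (∑ j, y j) / n) ^ 2)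

lemma Rq_eq_zero_iff (y : ℝ) : Rq y = 0 ↔ |y| ≤ 1 := by
  unfold Rq
  rw [abs_le]
  split_ifs with h₁ h₂
  · simp only [one_ne_zero, false_iff, not_and, not_le]
    exact fun _ => h₁
  · simp only [neg_eq_zero, one_ne_zero, false_iff, not_and, not_le]
    intro h
    linarith
  · simp only [true_iff]
    exact ⟨by linarith, by linarith⟩

lemma abs_le_inv_of_Rq_eq_zero {a d : ℝ} (ha : 0 < a) (h : Rq (a * d) = 0) :
    |d| ≤ 1 / a := by
  rw [Rq_eq_zero_iff, abs_mul, abs_of_pos ha] at h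
  rw [le_div_iff₀ ha]
  linarith

/-- A nonzero quantized message shrinks the error by exactly the step size. -/
lemma abs_sub_Rq_div_of_ne_zero {a d : ℝ} (ha : 0 < a) (h : Rq (a * d) ≠ 0) :
    |d - Rq (a * d) / a| = |d| - 1 / a := by
  have ha' : 0 < 1 / a := by positivity
  unfold Rq at h ⊢
  split_ifs at h ⊢ with h₁ h₂
  · have hd : 1 / a < d := by
      rw [div_lt_iff₀ ha]
      linarith
    rw [abs_of_pos (by linarith), abs_of_pos (by linarith)]
  · have hd : d < -(1 / a) := by
      rw [← neg_div, lt_div_iff₀ ha]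
      linarith
    rw [neg_div, abs_of_neg (by linarith : d < 0), abs_of_neg (by linarith)]
    ring
  · exact absurd rfl h

lemma abs_sub_Rq_div_le_max {a d : ℝ} (ha : 0 < a) :
    |d - Rq (a * d) / a| ≤ max (|d| - 1 / a) (1 / a) := by
  by_cases h : Rq (a * d) = 0
  · rw [h, zero_div, sub_zero]
    exact (abs_le_inv_of_Rq_eq_zero ha h).trans (le_max_right _ _)
  · exact (abs_sub_Rq_div_of_ne_zero ha h).le.trans (le_max_left _ _)

lemma abs_sub_Rq_div_le {a d : ℝ} (ha : 0 < a) : |d - Rq (a * d) / a| ≤ |d| := by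
  by_cases h : Rq (a * d) = 0
  · rw [h, zero_div, sub_zero]
  · rw [abs_sub_Rq_div_of_ne_zero ha h]
    have : 0 < 1 / a := by positivity
    linarith

/-- The updated estimate stays in any symmetric interval containing the old estimate and
the quantized value. -/
lemma abs_add_Rq_div_le {a x o X : ℝ} (ha : 0 < a) (hx : |x| ≤ X) (ho : |o| ≤ X) :
    |o + Rq (a * (x - o)) / a| ≤ X := by
  have ha' : 0 < 1 / a := by positivity
  rw [abs_le] at *
  unfold Rq
  split_ifs with h₁ h₂
  · have hd : 1 / a < x - o := by
      rw [div_lt_iff₀ ha]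
      linarith
    constructor <;> linarith
  · have hd : x - o < -(1 / a) := by
      rw [← neg_div, lt_div_iff₀ ha]
      linarith
    rw [neg_div]
    constructor <;> linarith
  · simpa using ho

namespace Protocol

variable {n : ℕ} (P : Protocol n)

lemma xin_eq_xout (t : ℕ) (i j : Fin n) : P.xin t i j = P.xout t j i := by
  induction t with
  | zero => rw [P.hxin0, P.hxout0]
  | succ t ih =>
    have h1 : 1 ≤ t + 1 := by omega
    by_cases hE : P.E (t + 1) i j
    · rw [P.hxinE _ h1 _ _ hE, P.hxoutE _ h1 _ _ (P.Esymm _ _ _ hE)]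
      simp [ih]
    · rw [P.hxinN _ h1 _ _ hE, P.hxoutN _ h1 _ _ (fun h => hE (P.Esymm _ _ _ h))]
      simp [ih]

lemma xout_succ_of_E {t : ℕ} {i j : Fin n} (hE : P.E (t + 1) i j) :
    P.xout (t + 1) i j = P.xout t i j +
      Rq (((t + 1 : ℕ) : ℝ) ^ P.α * (P.x t i - P.xout t i j)) / ((t + 1 : ℕ) : ℝ) ^ P.α := by
  have h1 : 1 ≤ t + 1 := by omega
  rw [P.hxoutE _ h1 _ _ hE, P.hq _ h1 _ _ hE]
  simp

lemma succ_rpow_pos (t : ℕ) (a : ℝ) : 0 < ((t + 1 : ℕ) : ℝ) ^ a :=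
  Real.rpow_pos_of_pos (by positivity) _

lemma abs_xout_sub_x_le_of_q_eq_zero {t : ℕ} {i j : Fin n} (hE : P.E (t + 1) i j)
    (hq : P.q (t + 1) i j = 0) :
    |P.xout (t + 1) i j - P.x t i| ≤ 1 / ((t + 1 : ℕ) : ℝ) ^ P.α := by
  have h1 : 1 ≤ t + 1 := by omega
  have h := P.hxoutE _ h1 _ _ hE
  have hq' := P.hq _ h1 _ _ hE
  rw [hq] at h hq'
  simp only [Nat.add_sub_cancel, zero_div, add_zero] at h hq'
  rw [h, abs_sub_comm]
  exact abs_le_inv_of_Rq_eq_zero (succ_rpow_pos t _) hq'.symm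

/-- The increment of node `i` at time `t + 1`, before scaling by `(t + 1)^(-β)`. -/
lemma sum_increment_bounds {t : ℕ} {m M : ℝ} (hm : ∀ i, m ≤ P.x t i) (hM : ∀ i, P.x t i ≤ M)
    (i : Fin n) :
    -((P.x t i - m) / 2) ≤
      ∑ j ∈ P.S (t + 1) i, (P.xin (t + 1) i j - P.xout (t + 1) i j) / (4 * P.D i j (t + 1)) ∧
    ∑ j ∈ P.S (t + 1) i, (P.xin (t + 1) i j - P.xout (t + 1) i j) / (4 * P.D i j (t + 1)) ≤
      (M - P.x t i) / 2 := by
  set s := P.S (t + 1) i with hs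
  have key : ∀ j ∈ s, -((P.x t i - m) / (2 * s.card)) ≤
      (P.xin (t + 1) i j - P.xout (t + 1) i j) / (4 * P.D i j (t + 1)) ∧
      (P.xin (t + 1) i j - P.xout (t + 1) i j) / (4 * P.D i j (t + 1)) ≤
        (M - P.x t i) / (2 * s.card) := by
    intro j hj
    have hc : (0 : ℝ) < s.card := by exact_mod_cast Finset.card_pos.mpr ⟨j, hj⟩
    have hj' := hj
    simp only [hs, S, Finset.mem_filter, Finset.mem_univ, true_and] at hj'
    obtain ⟨hE, hbig, hqji, hqij⟩ := hj'
    have hD : (s.card : ℝ) ≤ P.D i j (t + 1) := by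
      refine le_trans ?_ (P.Dbound _ _ _ hE)
      norm_cast
      refine le_trans ?_ (le_max_left _ _)
      rw [← Set.ncard_coe_finset]
      refine Set.ncard_le_ncard (fun k hk => ?_) (Set.toFinite _)
      simp only [hs, S, Finset.coe_filter, Set.mem_ofPred_eq] at hk
      exact hk.2.1
    have h₁ := abs_le.mp (P.abs_xout_sub_x_le_of_q_eq_zero hE hqij)
    have h₂ := abs_le.mp (P.abs_xout_sub_x_le_of_q_eq_zero (P.Esymm _ _ _ hE) hqji)
    rw [P.xin_eq_xout] at hbig ⊢
    have h4 : 4 / ((t + 1 : ℕ) : ℝ) ^ P.α = 4 * (1 / ((t + 1 : ℕ) : ℝ) ^ P.α) := by ring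
    rw [h4] at hbig
    have hr : 0 < 1 / ((t + 1 : ℕ) : ℝ) ^ P.α := one_div_pos.mpr (succ_rpow_pos t _)
    generalize 1 / ((t + 1 : ℕ) : ℝ) ^ P.α = r at *
    have hmi := hm i
    have hmj := hm j
    have hMi := hM i
    have hMj := hM j
    have hup : P.xout (t + 1) j i - P.xout (t + 1) i j ≤ 2 * (M - P.x t i) := by
      rcases lt_abs.mp hbig with h | h <;> linarith
    have hlo : -(2 * (P.x t i - m)) ≤ P.xout (t + 1) j i - P.xout (t + 1) i j := by
      rcases lt_abs.mp hbig with h | h <;> linarith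
    have hDpos : 0 < P.D i j (t + 1) := hc.trans_le hD
    constructor
    · rw [← neg_div, div_le_div_iff₀ (by positivity) (by positivity)]
      have := mul_le_mul_of_nonneg_left hD (sub_nonneg.mpr hmi)
      have := mul_le_mul_of_nonneg_right hlo hc.le
      nlinarith
    · rw [div_le_div_iff₀ (by positivity) (by positivity)]
      have := mul_le_mul_of_nonneg_left hD (sub_nonneg.mpr hMi)
      have := mul_le_mul_of_nonneg_right hup hc.le
      nlinarith
  have hmi := hm i
  have hMi := hM i
  rcases s.eq_empty_or_nonempty with h0 | hne
  · rw [h0, Finset.sum_empty]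
    constructor <;> linarith
  have hc : (s.card : ℝ) ≠ 0 := by exact_mod_cast (Finset.card_pos.mpr hne).ne'
  constructor
  · have := Finset.card_nsmul_le_sum s _ _ (fun j hj => (key j hj).1)
    rw [nsmul_eq_mul] at this
    refine le_trans (le_of_eq ?_) this
    field_simp
  · have := Finset.sum_le_card_nsmul s _ _ (fun j hj => (key j hj).2)
    rw [nsmul_eq_mul] at this
    refine this.trans (le_of_eq ?_)
    field_simp

lemma x_succ (t : ℕ) (i : Fin n) :
    P.x (t + 1) i = P.x t i + (1 / ((t + 1 : ℕ) : ℝ) ^ P.β) *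
      ∑ j ∈ P.S (t + 1) i, (P.xin (t + 1) i j - P.xout (t + 1) i j) / (4 * P.D i j (t + 1)) :=
  P.hx (t + 1) (by omega) i

lemma one_div_succ_rpow_le_one (t : ℕ) : 1 / ((t + 1 : ℕ) : ℝ) ^ P.β ≤ 1 := by
  rw [div_le_one (succ_rpow_pos t _)]
  exact Real.one_le_rpow (by push_cast; linarith [(Nat.cast_nonneg t : (0 : ℝ) ≤ t)])
    (P.hα.trans P.hαβ).le

lemma x_mem_Icc {m M : ℝ} (h0 : ∀ i, P.x 0 i ∈ Set.Icc m M) (t : ℕ) :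
    ∀ i, P.x t i ∈ Set.Icc m M := by
  induction t with
  | zero => exact h0
  | succ t ih =>
    intro i
    obtain ⟨hlo, hup⟩ := P.sum_increment_bounds (fun i => (ih i).1) (fun i => (ih i).2) i
    have hc := P.one_div_succ_rpow_le_one t
    have hc0 : 0 < 1 / ((t + 1 : ℕ) : ℝ) ^ P.β := one_div_pos.mpr (succ_rpow_pos t _)
    have h1 := (ih i).1
    have h2 := (ih i).2
    rw [Set.mem_Icc, P.x_succ]
    generalize 1 / ((t + 1 : ℕ) : ℝ) ^ P.β = c at *
    constructor <;> nlinarith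

lemma abs_x_succ_sub_le {m M : ℝ} (h0 : ∀ i, P.x 0 i ∈ Set.Icc m M) (t : ℕ) (i : Fin n) :
    |P.x (t + 1) i - P.x t i| ≤ (M - m) / 2 * (1 / ((t + 1 : ℕ) : ℝ) ^ P.β) := by
  have ih := P.x_mem_Icc h0 t
  obtain ⟨hlo, hup⟩ := P.sum_increment_bounds (fun i => (ih i).1) (fun i => (ih i).2) i
  have hc0 : 0 < 1 / ((t + 1 : ℕ) : ℝ) ^ P.β := one_div_pos.mpr (succ_rpow_pos t _)
  have h1 := (ih i).1
  have h2 := (ih i).2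
  rw [P.x_succ, add_sub_cancel_left, abs_mul, abs_of_pos hc0, mul_comm]
  refine mul_le_mul_of_nonneg_right (abs_le.mpr ⟨?_, ?_⟩) hc0.le <;> linarith

lemma abs_xout_le {X : ℝ} (h0 : ∀ i, P.x 0 i ∈ Set.Icc (-X) X) (t : ℕ) (i j : Fin n) :
    |P.xout t i j| ≤ X := by
  have hx := fun t => abs_le.mpr (P.x_mem_Icc h0 t i)
  induction t with
  | zero =>
    rw [P.hxout0, abs_zero]
    exact (abs_nonneg _).trans (hx 0)
  | succ t ih =>
    by_cases hE : P.E (t + 1) i j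
    · rw [P.xout_succ_of_E hE]
      exact abs_add_Rq_div_le (succ_rpow_pos t _) (hx t) ih
    · rw [P.hxoutN _ (by omega) _ _ hE]
      exact ih

/-- The estimation error `|x_i(t) - x̂_{i,j,out}(t)|`. -/
def err (i j : Fin n) (t : ℕ) : ℝ := |P.x t i - P.xout t i j|

lemma err_succ_le_abs_add {m M : ℝ} (h0 : ∀ i, P.x 0 i ∈ Set.Icc m M) (i j : Fin n)
    (t : ℕ) :
    P.err i j (t + 1) ≤ |P.x t i - P.xout (t + 1) i j| +
      (M - m) / 2 * (1 / ((t + 1 : ℕ) : ℝ) ^ P.β) := by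
  have h := P.abs_x_succ_sub_le h0 t i
  have := abs_sub_le (P.x (t + 1) i) (P.x t i) (P.xout (t + 1) i j)
  unfold err
  linarith

lemma err_succ_le {m M : ℝ} (h0 : ∀ i, P.x 0 i ∈ Set.Icc m M) (i j : Fin n)
    (t : ℕ) :
    P.err i j (t + 1) ≤ P.err i j t + (M - m) / 2 * (1 / ((t + 1 : ℕ) : ℝ) ^ P.β) := by
  refine (P.err_succ_le_abs_add h0 i j t).trans (add_le_add_left ?_ _)
  by_cases hE : P.E (t + 1) i j
  · rw [P.xout_succ_of_E hE, ← sub_sub]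
    exact abs_sub_Rq_div_le (succ_rpow_pos t _)
  · rw [P.hxoutN _ (by omega) _ _ hE]
    exact le_rfl

lemma err_add_le {m M : ℝ} (h0 : ∀ i, P.x 0 i ∈ Set.Icc m M) (i j : Fin n)
    {T : ℕ} (hT : 0 < T) {t : ℕ} (hTt : T ≤ t) (l : ℕ) :
    P.err i j (t + l) ≤ P.err i j t + l * ((M - m) / 2 * (1 / (T : ℝ) ^ P.β)) := by
  have hW : 0 ≤ M - m := by linarith [(h0 i).1, (h0 i).2]
  induction l with
  | zero => simp
  | succ l ih =>
    have h := P.err_succ_le h0 i j (t + l)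
    have hT' : (0 : ℝ) < T := by exact_mod_cast hT
    have : 1 / ((t + l + 1 : ℕ) : ℝ) ^ P.β ≤ 1 / (T : ℝ) ^ P.β := by
      refine one_div_le_one_div_of_le (Real.rpow_pos_of_pos hT' _) ?_
      refine Real.rpow_le_rpow hT'.le ?_ (P.hα.trans P.hαβ).le
      exact_mod_cast (by omega : T ≤ t + l + 1)
    have := mul_le_mul_of_nonneg_left this (by linarith : 0 ≤ (M - m) / 2)
    push_cast at *
    rw [← add_assoc]
    linarith

/-- Evolution of the error over a window in which the edge appears. -/
lemma err_window_le {m M : ℝ} (h0 : ∀ i, P.x 0 i ∈ Set.Icc m M) (i j : Fin n)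
    {T B : ℕ} (hT : 0 < T)
    (hE : ∃ s, T + 1 ≤ s ∧ s ≤ T + B ∧ P.E s i j) :
    P.err i j (T + B) ≤ max (P.err i j T - 1 / ((T + B : ℕ) : ℝ) ^ P.α) (1 / (T : ℝ) ^ P.α) +
      B * ((M - m) / 2 * (1 / (T : ℝ) ^ P.β)) := by
  have hW : 0 ≤ M - m := by linarith [(h0 i).1, (h0 i).2]
  obtain ⟨s, hs₁, hs₂, hEs⟩ := hE
  obtain ⟨l, rfl⟩ : ∃ l, s = T + l + 1 := ⟨s - T - 1, by omega⟩
  obtain ⟨p, rfl⟩ : ∃ p, B = l + 1 + p := ⟨B - l - 1, by omega⟩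
  have hT' : (0 : ℝ) < T := by exact_mod_cast hT
  have h₁ := P.err_add_le h0 i j hT le_rfl l
  have h₂ := P.err_succ_le_abs_add h0 i j (T + l)
  have h₃ := P.err_add_le h0 i j hT (by omega : T ≤ T + l + 1) p
  have hβ : 1 / ((T + l + 1 : ℕ) : ℝ) ^ P.β ≤ 1 / (T : ℝ) ^ P.β := by
    refine one_div_le_one_div_of_le (Real.rpow_pos_of_pos hT' _) ?_
    refine Real.rpow_le_rpow hT'.le ?_ (P.hα.trans P.hαβ).le
    exact_mod_cast (by omega : T ≤ T + l + 1)
  have hβ := mul_le_mul_of_nonneg_left hβ (by linarith : 0 ≤ (M - m) / 2)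
  have hα₁ : 1 / ((T + l + 1 : ℕ) : ℝ) ^ P.α ≤ 1 / (T : ℝ) ^ P.α := by
    refine one_div_le_one_div_of_le (Real.rpow_pos_of_pos hT' _) ?_
    refine Real.rpow_le_rpow hT'.le ?_ P.hα.le
    exact_mod_cast (by omega : T ≤ T + l + 1)
  have hα₂ : 1 / ((T + (l + 1 + p) : ℕ) : ℝ) ^ P.α ≤ 1 / ((T + l + 1 : ℕ) : ℝ) ^ P.α := by
    refine one_div_le_one_div_of_le (succ_rpow_pos _ _) ?_
    refine Real.rpow_le_rpow (by positivity) ?_ P.hα.le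
    exact_mod_cast (by omega : T + l + 1 ≤ T + (l + 1 + p))
  have hstep : |P.x (T + l) i - P.xout (T + l + 1) i j| ≤
      max (P.err i j (T + l) - 1 / ((T + l + 1 : ℕ) : ℝ) ^ P.α)
        (1 / ((T + l + 1 : ℕ) : ℝ) ^ P.α) := by
    rw [P.xout_succ_of_E hEs, ← sub_sub]
    exact abs_sub_Rq_div_le_max (succ_rpow_pos _ _)
  have hδ : 0 ≤ (M - m) / 2 * (1 / (T : ℝ) ^ P.β) := by positivity
  rw [show T + (l + 1 + p) = T + l + 1 + p by ring] at *
  push_cast at *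
  generalize (M - m) / 2 * (1 / (T : ℝ) ^ P.β) = δ at *
  have hlδ : 0 ≤ (l : ℝ) * δ := by positivity
  have hmax : |P.x (T + l) i - P.xout (T + l + 1) i j| ≤
      max (P.err i j T - 1 / ((T : ℝ) + l + 1 + p) ^ P.α) (1 / (T : ℝ) ^ P.α) + l * δ := by
    rw [← max_add_add_right]
    exact hstep.trans (max_le_max (by linarith) (by linarith))
  linarith

end Protocol

lemma one_div_rpow_ratio {α : ℝ} (hα1 : α < 1) {a b c : ℝ} (ha : 0 < a)
    (hab : a ≤ b) (hc : b ≤ c * a) : 1 / a ^ α ≤ c * (1 / b ^ α) := by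
  have hb : 0 < b := ha.trans_le hab
  have h : (b / a) ^ α ≤ c := by
    have h1 : 1 ≤ b / a := (one_le_div ha).mpr hab
    calc (b / a) ^ α ≤ (b / a) ^ (1 : ℝ) := Real.rpow_le_rpow_of_exponent_le h1 hα1.le
      _ = b / a := Real.rpow_one _
      _ ≤ c := (div_le_iff₀ ha).mpr hc
  rw [Real.div_rpow hb.le ha.le, div_le_iff₀ (Real.rpow_pos_of_pos ha _)] at h
  rw [mul_one_div, div_le_div_iff₀ (Real.rpow_pos_of_pos ha _) (Real.rpow_pos_of_pos hb _)]
  linarith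

/-- A sequence which decreases by at least `u (k + 1) / 2` in each step until it is
comparable to `u` stays comparable to `u` from then on. -/
lemma le_max_of_window_recursion {e u : ℕ → ℝ} {C : ℝ} {k₀ : ℕ} (he : e k₀ ≤ C)
    (hu : ∀ k, k₀ ≤ k → 0 ≤ u k)
    (hanti : ∀ k, k₀ ≤ k → u (k + 1) ≤ u k)
    (hratio : ∀ k, k₀ ≤ k → u k ≤ 17 / 16 * u (k + 1))
    (hstep : ∀ k, k₀ ≤ k → e (k + 1) ≤ max (e k - u (k + 1)) (u k) + u k / 16) (l : ℕ) :
    e (k₀ + l) ≤ max (C - l / 2 * u (k₀ + l)) (5 / 4 * u (k₀ + l)) := by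
  induction l with
  | zero => simp [he]
  | succ l ih =>
    have hk : k₀ ≤ k₀ + l := by omega
    have h₁ := hanti _ hk
    have h₂ := hratio _ hk
    have h₃ := hstep _ hk
    have h₄ := hu (k₀ + l + 1) (by omega)
    rw [← add_assoc]
    push_cast
    have hl : (l : ℝ) / 2 * u (k₀ + l + 1) ≤ (l : ℝ) / 2 * u (k₀ + l) := by gcongr
    rw [le_max_iff]
    rcases le_max_iff.mp ih with h | h <;>
      rcases max_cases (e (k₀ + l) - u (k₀ + l + 1)) (u (k₀ + l)) with ⟨h', -⟩ | ⟨h', -⟩ <;>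
      rw [h'] at h₃
    · left; linarith
    · right; linarith
    · right; linarith
    · right; linarith

/-- The consequences of the lower bound on `t` which the proof uses. -/
lemma exists_late_time {α β B W X t : ℝ} (hα : 0 < α) (hαβ : α < β) (hβ : β < 1)
    (hB1 : 1 ≤ B) (hW0 : 0 ≤ W) (hX0 : 0 ≤ X)
    (ht : (2 : ℝ) ^ ((2 : ℝ) / (1 - α)) *
        ((⌈32 * B + 8 * B * W⌉ : ℝ)) ^ ((1 : ℝ) / (β - α)) +
        (32 * B * X) ^ ((2 : ℝ) / (1 - α)) + 1 ≤ t) :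
    ∃ T₀ : ℝ, 32 * B ≤ T₀ ∧ 8 * B * W ≤ T₀ ^ (β - α) ∧ 4 * T₀ + 1 ≤ t ∧
      32 * B * X ≤ t ^ (1 - α) := by
  have hBW : 0 ≤ B * W := by positivity
  have hNle : 32 * B + 8 * B * W ≤ (⌈32 * B + 8 * B * W⌉ : ℝ) := Int.le_ceil _
  generalize (⌈32 * B + 8 * B * W⌉ : ℝ) = N at *
  have hN1 : 1 ≤ N := by linarith
  have hβα : 0 < β - α := by linarith
  have hNT : N ≤ N ^ ((1 : ℝ) / (β - α)) := by
    have : (1 : ℝ) ≤ 1 / (β - α) := by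
      rw [le_div_iff₀ hβα]
      linarith
    calc N = N ^ (1 : ℝ) := (Real.rpow_one N).symm
      _ ≤ _ := Real.rpow_le_rpow_of_exponent_le hN1 this
  have hTpow : (N ^ ((1 : ℝ) / (β - α))) ^ (β - α) = N := by
    rw [← Real.rpow_mul (by linarith), one_div_mul_cancel hβα.ne', Real.rpow_one]
  generalize N ^ ((1 : ℝ) / (β - α)) = T₀ at *
  have hL : 0 < 1 - α := by linarith
  have hpow2 : (4 : ℝ) ≤ 2 ^ ((2 : ℝ) / (1 - α)) := by
    have : (2 : ℝ) ≤ 2 / (1 - α) := by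
      rw [le_div_iff₀ hL]
      linarith
    calc (4 : ℝ) = 2 ^ (2 : ℝ) := by norm_num
      _ ≤ _ := Real.rpow_le_rpow_of_exponent_le (by norm_num) this
  have hXpow : 0 ≤ (32 * B * X) ^ ((2 : ℝ) / (1 - α)) := by positivity
  have hT : 4 * T₀ ≤ 2 ^ ((2 : ℝ) / (1 - α)) * T₀ :=
    mul_le_mul_of_nonneg_right hpow2 (by linarith)
  have htX : (32 * B * X) ^ ((2 : ℝ) / (1 - α)) ≤ t := by linarith
  refine ⟨T₀, by linarith, by linarith, by linarith, ?_⟩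
  have hsq : (32 * B * X) ^ (2 : ℝ) ≤ t ^ (1 - α) := by
    have := Real.rpow_le_rpow hXpow htX hL.le
    rwa [← Real.rpow_mul (by positivity), div_mul_cancel₀ _ hL.ne'] at this
  rw [Real.rpow_two] at hsq
  have h1 := Real.one_le_rpow (by linarith : 1 ≤ t) hL.le
  nlinarith [sq_nonneg (32 * B * X - 1)]

/-- after a nonzero message on a core edge at a late enough time, the
message on that edge is zero for the next `3B` steps whenever the edge appears. -/
theorem stmt11_zero_after_nonzero {n : ℕ} (hn : 1 ≤ n) (P : Protocol n)
    (B : ℕ) (hB : 0 < B) (Einf : Fin n → Fin n → Prop)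
    (hcore : P.CoreConnected B Einf) (i j : Fin n) (hij : Einf i j)
    (t : ℕ)
    (ht : (2 : ℝ) ^ ((2 : ℝ) / (1 - P.α)) *
        ((⌈32 * (B : ℝ) + 8 * B * Wsp (P.x 0)⌉ : ℝ)) ^ ((1 : ℝ) / (P.β - P.α)) +
        (32 * B * normInf (P.x 0)) ^ ((2 : ℝ) / (1 - P.α)) + 1 ≤ (t : ℝ))
    (hE : P.E t i j) (hq : P.q t i j ≠ 0) :
    ∀ k, t + 1 ≤ k → k ≤ t + 3 * B → P.E k i j → P.q k i j = 0 := by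
  have hα := P.hα
  have hαβ := P.hαβ
  have hβ := P.hβ
  have : Nonempty (Fin n) := ⟨i⟩
  set X := normInf (P.x 0)
  set W := Wsp (P.x 0)
  have hmM : ∀ a, P.x 0 a ∈ Set.Icc (minV (P.x 0)) (maxV (P.x 0)) := fun a =>
    ⟨ciInf_le (Set.finite_range _).bddBelow a, le_ciSup (Set.finite_range _).bddAbove a⟩
  have hXb : ∀ a, P.x 0 a ∈ Set.Icc (-X) X := fun a =>
    abs_le.mp (le_ciSup (f := fun a => |P.x 0 a|) (Set.finite_range _).bddAbove a)
  have hW0 : 0 ≤ W := sub_nonneg.mpr ((hmM i).1.trans (hmM i).2)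
  have hX0 : 0 ≤ X := by linarith [(hXb i).1, (hXb i).2]
  have hB1 : (1 : ℝ) ≤ B := by exact_mod_cast hB
  obtain ⟨T₀, hT32, hTpow, ht4, hcatch⟩ := exists_late_time hα hαβ hβ hB1 hW0 hX0 ht
  have hβα : 0 < P.β - P.α := by linarith
  have ht1 : (1 : ℝ) ≤ t := by linarith
  have htnat : 1 ≤ t := by exact_mod_cast ht1
  -- the windows from `k₀` on are late, and `t` lies in window `K`
  set k₀ := ⌈T₀ / B⌉₊
  obtain ⟨K, hK⟩ : ∃ K, K = (t - 1) / B := ⟨_, rfl⟩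
  have hk₀T : T₀ ≤ k₀ * B := by
    rw [← div_le_iff₀ (by linarith)]
    exact Nat.le_ceil _
  have hk₀up : (k₀ : ℝ) < T₀ / B + 1 := Nat.ceil_lt_add_one (div_nonneg (by linarith) (by linarith))
  have hK₁ : K * B + 1 ≤ t := by
    have := Nat.div_mul_le_self (t - 1) B
    rw [← hK] at this
    omega
  have hK₂ : t ≤ (K + 1) * B := by
    have := Nat.lt_div_mul_add (a := t - 1) hB
    rw [← hK] at this
    rw [add_mul, one_mul]
    omega
  have hK₁' : (K : ℝ) * B + 1 ≤ t := by exact_mod_cast hK₁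
  have hK₂' : (t : ℝ) ≤ (K + 1) * B := by exact_mod_cast hK₂
  have hgap : (t : ℝ) / (2 * B) ≤ K - k₀ := by
    have h1 : (k₀ : ℝ) * B ≤ T₀ + B := by
      have := mul_le_mul_of_nonneg_right hk₀up.le (by linarith : (0 : ℝ) ≤ B)
      rwa [add_mul, one_mul, div_mul_cancel₀ _ (by linarith)] at this
    rw [div_le_iff₀ (by linarith)]
    linarith
  have hk₀K : k₀ ≤ K := by
    have : (0 : ℝ) ≤ (t : ℝ) / (2 * B) := by positivity
    exact_mod_cast (by linarith : (k₀ : ℝ) ≤ K)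
  set u : ℕ → ℝ := fun k => 1 / ((k * B : ℕ) : ℝ) ^ P.α with hu
  set δ : ℕ → ℝ := fun k => W / 2 * (1 / ((k * B : ℕ) : ℝ) ^ P.β) with hδ
  have hlate : ∀ k, k₀ ≤ k → T₀ ≤ ((k * B : ℕ) : ℝ) := by
    intro k hk
    refine hk₀T.trans ?_
    push_cast
    gcongr
  have hk32 : ∀ k, k₀ ≤ k → (32 : ℝ) ≤ k := by
    intro k hk
    have := hlate k hk
    push_cast at this
    exact le_of_mul_le_mul_right (hT32.trans this) (by linarith)
  have hTpos : 0 < T₀ := by linarith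
  have hpos : ∀ k, k₀ ≤ k → (0 : ℝ) < ((k * B : ℕ) : ℝ) := fun k hk => hTpos.trans_le (hlate k hk)
  have hu0 : ∀ k, k₀ ≤ k → 0 < u k := fun k hk =>
    one_div_pos.mpr (Real.rpow_pos_of_pos (hpos k hk) _)
  have hanti : ∀ k, k₀ ≤ k → u (k + 1) ≤ u k := by
    intro k hk
    refine one_div_le_one_div_of_le (Real.rpow_pos_of_pos (hpos k hk) _) ?_
    refine Real.rpow_le_rpow (hpos k hk).le ?_ hα.le
    push_cast
    linarith
  have hratio : ∀ k, k₀ ≤ k → u k ≤ 17 / 16 * u (k + 1) := by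
    intro k hk
    have := mul_le_mul_of_nonneg_right (hk32 k hk) (by linarith : (0 : ℝ) ≤ B)
    refine one_div_rpow_ratio (by linarith) (hpos k hk) ?_ ?_ <;>
      push_cast <;> linarith
  have hδu : ∀ k, k₀ ≤ k → B * δ k ≤ u k / 16 := by
    intro k hk
    have hp := hpos k hk
    have hNk : 8 * B * W ≤ ((k * B : ℕ) : ℝ) ^ (P.β - P.α) := by
      refine hTpow.trans ?_
      exact Real.rpow_le_rpow hTpos.le (hlate k hk) hβα.le
    have hsplit : ((k * B : ℕ) : ℝ) ^ P.β =
        ((k * B : ℕ) : ℝ) ^ P.α * ((k * B : ℕ) : ℝ) ^ (P.β - P.α) := by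
      rw [← Real.rpow_add hp]
      ring_nf
    have hpα := Real.rpow_pos_of_pos hp P.α
    have hpd := Real.rpow_pos_of_pos hp (P.β - P.α)
    simp only [hu, hδ]
    rw [hsplit]
    generalize ((k * B : ℕ) : ℝ) ^ (P.β - P.α) = d at *
    generalize ((k * B : ℕ) : ℝ) ^ P.α = a at *
    have : (B : ℝ) * (W / 2 * (1 / (a * d))) = B * W / (2 * d) * (1 / a) := by
      field_simp
    rw [this, div_eq_mul_inv (1 / a), mul_comm (1 / a)]
    refine mul_le_mul_of_nonneg_right ?_ (by positivity)
    rw [div_le_iff₀ (by positivity)]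
    linarith
  have herr₀ : P.err i j (k₀ * B) ≤ 2 * X := by
    have h1 := abs_le.mpr (P.x_mem_Icc hXb (k₀ * B) i)
    have h2 := P.abs_xout_le hXb (k₀ * B) i j
    have h3 := abs_sub (P.x (k₀ * B) i) (P.xout (k₀ * B) i j)
    unfold Protocol.err
    linarith
  have hstep : ∀ k, k₀ ≤ k → P.err i j ((k + 1) * B) ≤
      max (P.err i j (k * B) - u (k + 1)) (u k) + u k / 16 := by
    intro k hk
    have hw := P.err_window_le hmM i j (T := k * B) (B := B)
      (by exact_mod_cast hpos k hk) (by
        obtain ⟨s, h1, h2, h3⟩ := hcore.2.2 k i j hij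
        exact ⟨s, h1, by rw [add_mul, one_mul] at h2; exact h2, h3⟩)
    rw [show k * B + B = (k + 1) * B by ring] at hw
    exact hw.trans (add_le_add_right (hδu k hk) _)
  have hKerr : P.err i j (K * B) ≤ 5 / 4 * u K := by
    have h := le_max_of_window_recursion (e := fun k => P.err i j (k * B)) (u := u) herr₀
      (fun k hk => (hu0 k hk).le) hanti hratio hstep (K - k₀)
    rw [Nat.add_sub_cancel' hk₀K, Nat.cast_sub hk₀K] at h
    rcases le_max_iff.mp h with h | h
    swap
    · exact h
    have htα : 1 / (t : ℝ) ^ P.α ≤ u K := by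
      refine one_div_le_one_div_of_le (Real.rpow_pos_of_pos (hpos K hk₀K) _) ?_
      refine Real.rpow_le_rpow (hpos K hk₀K).le ?_ hα.le
      push_cast
      linarith
    have hprod : (t : ℝ) / (2 * B) * (1 / (t : ℝ) ^ P.α) ≤ (K - k₀) * u K :=
      mul_le_mul hgap htα (by positivity) (le_trans (by positivity) hgap)
    have hsub : (t : ℝ) / (2 * B) * (1 / (t : ℝ) ^ P.α) = (t : ℝ) ^ (1 - P.α) / (2 * B) := by
      rw [Real.rpow_sub (by linarith), Real.rpow_one]
      field_simp
    have h16 : 16 * X ≤ (t : ℝ) ^ (1 - P.α) / (2 * B) := by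
      rw [le_div_iff₀ (by linarith)]
      linarith
    have := hu0 K hk₀K
    linarith
  have hKpos : 0 < K * B := by exact_mod_cast hpos K hk₀K
  have hδ0 : 0 ≤ δ K := by positivity
  have hδK := hδu K hk₀K
  obtain ⟨p, rfl⟩ : ∃ p, t = K * B + p + 1 := ⟨t - K * B - 1, by omega⟩
  have hpB : p + 1 ≤ B := by
    rw [add_mul, one_mul] at hK₂
    omega
  have hpB' : (p : ℝ) + 1 ≤ B := by exact_mod_cast hpB
  have herr₁ : P.err i j (K * B + p) ≤ P.err i j (K * B) + p * δ K :=
    P.err_add_le hmM i j hKpos le_rfl p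
  have htα : u (K + 1) ≤ 1 / ((K * B + p + 1 : ℕ) : ℝ) ^ P.α := by
    refine one_div_le_one_div_of_le (Protocol.succ_rpow_pos _ _) ?_
    refine Real.rpow_le_rpow (by positivity) ?_ hα.le
    exact_mod_cast hK₂
  have hfire : |P.x (K * B + p) i - P.xout (K * B + p + 1) i j| =
      P.err i j (K * B + p) - 1 / ((K * B + p + 1 : ℕ) : ℝ) ^ P.α := by
    rw [P.hq _ htnat _ _ hE] at hq
    rw [P.xout_succ_of_E hE, ← sub_sub]
    exact abs_sub_Rq_div_of_ne_zero (Protocol.succ_rpow_pos _ _) hq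
  have herr₂ : P.err i j (K * B + p + 1) ≤
      P.err i j (K * B + p) - 1 / ((K * B + p + 1 : ℕ) : ℝ) ^ P.α + δ K := by
    rw [← hfire]
    refine (P.err_succ_le_abs_add hmM i j _).trans (add_le_add_right ?_ _)
    refine mul_le_mul_of_nonneg_left ?_ (div_nonneg hW0 zero_le_two)
    refine one_div_le_one_div_of_le (Real.rpow_pos_of_pos (hpos K hk₀K) _) ?_
    refine Real.rpow_le_rpow (by positivity) ?_ (by linarith)
    exact_mod_cast (by omega : K * B ≤ K * B + p + 1)
  intro k hk₁ hk₂ hEk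
  obtain ⟨l, rfl⟩ : ∃ l, k = K * B + p + 1 + l + 1 := ⟨k - (K * B + p + 1) - 1, by omega⟩
  have hl : ((l : ℝ) + 1) ≤ 3 * B := by exact_mod_cast (by omega : l + 1 ≤ 3 * B)
  have herr₃ : P.err i j (K * B + p + 1 + l) ≤ P.err i j (K * B + p + 1) + l * δ K :=
    P.err_add_le hmM i j hKpos (by omega) l
  have hkα : u K ≤ 9 / 8 * (1 / ((K * B + p + 1 + l + 1 : ℕ) : ℝ) ^ P.α) := by
    have := mul_le_mul_of_nonneg_right (hk32 K hk₀K) (by linarith : (0 : ℝ) ≤ B)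
    have := (Nat.cast_nonneg p : (0 : ℝ) ≤ p)
    have := (Nat.cast_nonneg l : (0 : ℝ) ≤ l)
    refine one_div_rpow_ratio (by linarith) (hpos K hk₀K) ?_ ?_ <;>
      push_cast <;> linarith
  have hsmall : P.err i j (K * B + p + 1 + l) ≤
      1 / ((K * B + p + 1 + l + 1 : ℕ) : ℝ) ^ P.α := by
    have hr := hratio K hk₀K
    have hpos' := hu0 K hk₀K
    have hp' : ((p : ℝ) + 1) * δ K ≤ B * δ K := mul_le_mul_of_nonneg_right hpB' hδ0
    have hl' : ((l : ℝ) + 1) * δ K ≤ 3 * B * δ K := mul_le_mul_of_nonneg_right hl hδ0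
    linarith
  rw [P.hq _ (by omega) _ _ hEk, Rq_eq_zero_iff, abs_mul,
    abs_of_pos (Protocol.succ_rpow_pos _ _), mul_comm,
    ← le_div_iff₀ (Protocol.succ_rpow_pos _ _)]
  exact hsmall
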